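/- Let m ≥ 4 be an integer and let a, b > 0 satisfy 4a² + b = 1. Consider the domain D := {z ∈ ℂ³ : (|z₁| + |z₂|)² + |z₃| < 1}. The map f(λ) := (a·λ, a·λ^{m−2}, b·λ^{m−1}) maps 𝔻 into D and is an m-geodesic of D, while the map φ(λ) := f(λ)/λ = (a, a·λ^{m−3}, b·λ^{m−2}) is not an (m−1)-geodesic of D. -/

import Mathlib

open Complex Metric Set Filter

noncomputable section

/-- The open unit disc `𝔻` in `ℂ`. -/
def unitDisc : Set ℂ := Metric.ball (0 : ℂ) 1

/-- The Möbius function `m_α(λ) = (λ - α)/(1 - conj α · λ)`. -/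
def mobius (a z : ℂ) : ℂ := (z - a) / (1 - (starRingEnd ℂ) a * z)

/-- `B` agrees on the unit disc with a finite Blaschke product
`ζ · ∏_{j=1}^k m_{α_j}` of degree `k` (here `ζ ∈ 𝕋`, `α_j ∈ 𝔻`). -/
def IsBlaschkeOn (B : ℂ → ℂ) (k : ℕ) : Prop :=
  ∃ (ζ : ℂ) (α : Fin k → ℂ), ‖ζ‖ = 1 ∧ (∀ j, ‖α j‖ < 1) ∧
    ∀ z ∈ unitDisc, B z = ζ * ∏ j, mobius (α j) z

variable {E : Type*} [NormedAddCommGroup E] [NormedSpace ℂ E]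

/-- `f` is a weak `m`-extremal for the nodes `lam` with respect to the domain `D`:
there is no map `h`, holomorphic on an open neighborhood of the closed unit disc
with values in `D`, interpolating `f` at all the nodes. -/
def WeakExtremalFor (D : Set E) (f : ℂ → E) {m : ℕ} (lam : Fin m → ℂ) : Prop :=
  ¬ ∃ (U : Set ℂ) (h : ℂ → E), IsOpen U ∧ Metric.closedBall (0 : ℂ) 1 ⊆ U ∧
      DifferentiableOn ℂ h U ∧ Set.MapsTo h U D ∧ ∀ j, h (lam j) = f (lam j)

/-- `f` is a weak `m`-extremal of `D`: it is a weak `m`-extremal for some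
pairwise distinct nodes in the unit disc. -/
def IsWeakExtremal (D : Set E) (f : ℂ → E) (m : ℕ) : Prop :=
  ∃ lam : Fin m → ℂ, Function.Injective lam ∧ (∀ j, lam j ∈ unitDisc) ∧
    WeakExtremalFor D f lam

/-- `f` is an `m`-extremal of `D`: it is a weak `m`-extremal for every choice of
pairwise distinct nodes in the unit disc. -/
def IsExtremal (D : Set E) (f : ℂ → E) (m : ℕ) : Prop :=
  ∀ lam : Fin m → ℂ, Function.Injective lam → (∀ j, lam j ∈ unitDisc) →
    WeakExtremalFor D f lam

/-- `f` is an `m`-geodesic of `D`: there is a holomorphic `F : D → 𝔻` such that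
`F ∘ f` is a non-constant Blaschke product of degree at most `m - 1`. -/
def IsGeodesic (D : Set E) (f : ℂ → E) (m : ℕ) : Prop :=
  ∃ F : E → ℂ, DifferentiableOn ℂ F D ∧ Set.MapsTo F D unitDisc ∧
    ∃ k : ℕ, 1 ≤ k ∧ k ≤ m - 1 ∧ IsBlaschkeOn (fun z => F (f z)) k

/-- A domain `D ⊆ ℂⁿ` is `k`-balanced (quasi-balanced) if
`(λ^{k₁} z₁, …, λ^{k_n} z_n) ∈ D` for all `λ` in the closed unit disc, `z ∈ D`. -/
def QuasiBalanced {n : ℕ} (k : Fin n → ℕ) (D : Set (Fin n → ℂ)) : Prop :=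
  ∀ l : ℂ, ‖l‖ ≤ 1 → ∀ z ∈ D, (fun j => l ^ k j * z j) ∈ D

/-- The complex ellipsoid `E(p) = {z ∈ ℂⁿ : Σ_j |z_j|^{2 p_j} < 1}`. -/
def ellipsoid {n : ℕ} (p : Fin n → ℝ) : Set (Fin n → ℂ) :=
  {z | ∑ j, ‖z j‖ ^ (2 * p j) < 1}

/-- The Euclidean unit ball `𝔹_n ⊆ ℂⁿ`. -/
def euclideanBall (n : ℕ) : Set (Fin n → ℂ) :=
  {z | ∑ j, ‖z j‖ ^ 2 < 1}

section Helpers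

open Topology Asymptotics Polynomial ComplexConjugate

/-- A polynomial that is `O(z ^ N)` at the origin has no coefficients below degree `N`. -/
lemma polynomial_coeff_eq_zero_of_isBigO (N : ℕ) : ∀ (R : ℂ[X]),
    (fun z => R.eval z) =O[𝓝[≠] 0] (fun z : ℂ => z ^ N) → ∀ j < N, R.coeff j = 0 := by
  induction N with
  | zero => intro R _ j hj; omega
  | succ N ih =>
    intro R h j hj
    have h0 : R.coeff 0 = 0 := by
      have h1 : Tendsto (fun z : ℂ => z ^ (N + 1)) (𝓝[≠] 0) (𝓝 0) := by
        have : Tendsto (fun z : ℂ => z ^ (N + 1)) (𝓝 0) (𝓝 (0 ^ (N + 1))) :=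
          (continuous_pow _).tendsto _
        simpa using this.mono_left nhdsWithin_le_nhds
      have h2 : Tendsto (fun z => R.eval z) (𝓝[≠] 0) (𝓝 (R.eval 0)) :=
        (R.continuous.tendsto 0).mono_left nhdsWithin_le_nhds
      rw [coeff_zero_eq_eval_zero]
      exact tendsto_nhds_unique h2 (h.trans_tendsto h1)
    have hR : R = R.divX * X := by
      conv_lhs => rw [← R.divX_mul_X_add, h0]
      simp
    have h3 : (fun z => R.divX.eval z) =O[𝓝[≠] 0] (fun z : ℂ => z ^ N) := by
      obtain ⟨c, hc⟩ := h.bound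
      refine IsBigO.of_bound c ?_
      filter_upwards [hc, self_mem_nhdsWithin] with z hz hz0
      rw [hR, eval_mul, eval_X, norm_mul, pow_succ, norm_mul, ← mul_assoc] at hz
      exact le_of_mul_le_mul_right hz (norm_pos_iff.2 hz0)
    cases j with
    | zero => exact h0
    | succ j =>
      have := ih _ h3 j (by omega)
      rwa [coeff_divX] at this

lemma one_sub_conj_mul_ne_zero {a z : ℂ} (ha : ‖a‖ ≤ 1) (hz : ‖z‖ < 1) :
    1 - conj a * z ≠ 0 := by
  intro h
  have h1 : conj a * z = 1 := (sub_eq_zero.1 h).symm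
  have h2 : ‖a‖ * ‖z‖ = 1 := by simpa using congrArg norm h1
  nlinarith [norm_nonneg z, norm_nonneg a]

lemma norm_mobius_lt_one {a z : ℂ} (ha : ‖a‖ < 1) (hz : ‖z‖ < 1) : ‖mobius a z‖ < 1 := by
  have h0 := one_sub_conj_mul_ne_zero ha.le hz
  rw [mobius, norm_div, div_lt_one (norm_pos_iff.2 h0)]
  refine lt_of_pow_lt_pow_left₀ 2 (norm_nonneg _) ?_
  have ha2 : ‖a‖ ^ 2 < 1 := by nlinarith [norm_nonneg a]
  have hz2 : ‖z‖ ^ 2 < 1 := by nlinarith [norm_nonneg z]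
  rw [← normSq_eq_norm_sq] at *
  rw [← normSq_eq_norm_sq] at *
  rw [normSq_apply] at *
  rw [normSq_apply] at *
  simp only [sub_re, sub_im, mul_re, mul_im, conj_re, conj_im, one_re, one_im]
  nlinarith [mul_pos (sub_pos.2 ha2) (sub_pos.2 hz2)]

lemma differentiableAt_mobius {a z : ℂ} (ha : ‖a‖ ≤ 1) (hz : ‖z‖ < 1) :
    DifferentiableAt ℂ (mobius a) z := by
  unfold mobius
  exact DifferentiableAt.div (by fun_prop) (by fun_prop) (one_sub_conj_mul_ne_zero ha hz)

lemma mobius_self (a : ℂ) : mobius a a = 0 := by simp [mobius]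

lemma deriv_mobius_self {a : ℂ} (ha : ‖a‖ < 1) :
    deriv (mobius a) a = 1 / (1 - (‖a‖ : ℂ) ^ 2) := by
  have h0 := one_sub_conj_mul_ne_zero ha.le ha
  have h1 : HasDerivAt (fun z : ℂ => z - a) 1 a := (hasDerivAt_id a).sub_const a
  have h2 : HasDerivAt (fun z : ℂ => 1 - conj a * z) (-(conj a * 1)) a :=
    ((hasDerivAt_id a).const_mul (conj a)).const_sub 1
  have h3 := (h1.div h2 h0).deriv
  have h4 : deriv (mobius a) a = _ := h3
  rw [h4, ← Complex.conj_mul']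
  field_simp
  ring

/-- The Schwarz–Pick inequality at the origin, for maps into the open disc. -/
lemma schwarz_pick_of_mapsTo_ball {S : ℂ → ℂ} (hd : DifferentiableOn ℂ S (ball 0 1))
    (hm : MapsTo S (ball 0 1) (ball 0 1)) : ‖S 0‖ ^ 2 + ‖deriv S 0‖ ≤ 1 := by
  have h0 : (0 : ℂ) ∈ ball (0 : ℂ) 1 := by simp
  have hS0 : ‖S 0‖ < 1 := by simpa using hm h0
  have hgd : DifferentiableOn ℂ (mobius (S 0) ∘ S) (ball 0 1) := fun z hz =>
    ((differentiableAt_mobius hS0.le (by simpa using hm hz)).comp z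
      (hd.differentiableAt (isOpen_ball.mem_nhds hz))).differentiableWithinAt
  have hgm : MapsTo (mobius (S 0) ∘ S) (ball 0 1) (closedBall ((mobius (S 0) ∘ S) 0) 1) := by
    intro z hz
    simp only [Function.comp, mobius_self, mem_closedBall, dist_zero_right]
    exact (norm_mobius_lt_one hS0 (by simpa using hm hz)).le
  have h1 := norm_deriv_le_one_of_mapsTo_ball hgd hgm one_pos
  rw [deriv_comp _ (differentiableAt_mobius hS0.le hS0)
    (hd.differentiableAt (isOpen_ball.mem_nhds h0)), deriv_mobius_self hS0, norm_mul] at h1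
  have h2 : 0 < 1 - ‖S 0‖ ^ 2 := by nlinarith [norm_nonneg (S 0)]
  have h3 : ‖1 / (1 - (‖S 0‖ : ℂ) ^ 2)‖ = 1 / (1 - ‖S 0‖ ^ 2) := by
    have : (1 / (1 - (‖S 0‖ : ℂ) ^ 2)) = ((1 / (1 - ‖S 0‖ ^ 2) : ℝ) : ℂ) := by push_cast; rfl
    rw [this, norm_real, Real.norm_of_nonneg (by positivity)]
  rw [h3, one_div, inv_mul_le_iff₀ h2] at h1
  linarith

lemma schwarz_pick_of_mapsTo_closedBall {S : ℂ → ℂ} (hd : DifferentiableOn ℂ S (ball 0 1))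
    (hm : MapsTo S (ball 0 1) (closedBall 0 1)) : ‖S 0‖ ^ 2 + ‖deriv S 0‖ ≤ 1 := by
  have key : ∀ r : ℝ, r ∈ Ioo 0 1 → r ^ 2 * ‖S 0‖ ^ 2 + r * ‖deriv S 0‖ ≤ 1 := by
    intro r hr
    have h1 := schwarz_pick_of_mapsTo_ball (S := fun z => (r : ℂ) * S z) (hd.const_mul _) (by
      intro z hz
      have := hm hz
      simp only [mem_closedBall, dist_zero_right, mem_ball, norm_mul, norm_real,
        Real.norm_of_nonneg hr.1.le] at this ⊢
      nlinarith [hr.1, hr.2])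
    rw [deriv_const_mul_field] at h1
    simpa [norm_mul, mul_pow, abs_of_pos hr.1] using h1
  have hlim : Tendsto (fun r : ℝ => r ^ 2 * ‖S 0‖ ^ 2 + r * ‖deriv S 0‖) (𝓝[<] 1)
      (𝓝 (1 ^ 2 * ‖S 0‖ ^ 2 + 1 * ‖deriv S 0‖)) :=
    (Continuous.tendsto (by fun_prop) 1).mono_left nhdsWithin_le_nhds
  have := le_of_tendsto hlim (by
    filter_upwards [Ioo_mem_nhdsLT (zero_lt_one' ℝ)] with r hr using key r hr)
  simpa using this

/-- Schwarz–Pick for the two leading Taylor coefficients of a bounded function vanishing to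
order `n` at the origin. -/
lemma norm_sq_add_norm_le_one_of_expansion {T : ℂ → ℂ} {n : ℕ} (hn : 1 ≤ n) {c₀ c₁ : ℂ}
    (hd : DifferentiableOn ℂ T (ball 0 1)) (hm : MapsTo T (ball 0 1) (closedBall 0 1))
    (hT : (fun z => T z - (c₀ * z ^ n + c₁ * z ^ (n + 1))) =O[𝓝 0] fun z => z ^ (n + 2)) :
    ‖c₀‖ ^ 2 + ‖c₁‖ ≤ 1 := by
  have hpow : ∀ k : ℕ, n ≤ k → (fun z : ℂ => z ^ k) =O[𝓝 0] fun z : ℂ => z ^ n := fun k hk =>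
    IsBigO.of_bound 1 (by
      filter_upwards [ball_mem_nhds (0 : ℂ) one_pos] with z hz
      rw [one_mul, norm_pow, norm_pow]
      exact pow_le_pow_of_le_one (norm_nonneg _) (by simpa using (mem_ball.1 hz).le) hk)
  have hTn : T =O[𝓝 0] fun z => z ^ n := by
    have h1 := hT.trans (hpow (n + 2) (by omega))
    have h2 : (fun z : ℂ => c₀ * z ^ n + c₁ * z ^ (n + 1)) =O[𝓝 0] fun z => z ^ n :=
      ((hpow n le_rfl).const_mul_left _).add ((hpow (n + 1) (by omega)).const_mul_left _)
    simpa using h1.add h2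
  have hT0 : T 0 = 0 := hTn.eq_zero_imp.self_of_nhds (zero_pow (by omega))
  have hTle : ∀ z ∈ ball (0 : ℂ) 1, ‖T z‖ ≤ ‖z‖ ^ n := by
    intro z hz
    have ho : (T · - T 0) =o[𝓝 0] (fun w : ℂ => ‖w - 0‖ ^ (n - 1)) := by
      simp only [hT0, sub_zero]
      refine hTn.trans_isLittleO ?_
      rw [← isLittleO_norm_left]
      simp only [norm_pow]
      exact (isLittleO_pow_pow (show n - 1 < n by omega)).comp_tendsto
        (by simpa using (continuous_norm (E := ℂ)).tendsto 0)
    have := dist_le_mul_div_pow_of_mapsTo_ball_of_isLittleO (R₂ := 1) (n := n - 1) hd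
      (by rwa [hT0]) ho hz
    rw [Nat.sub_add_cancel hn] at this
    simpa [hT0] using this
  set S : ℂ → ℂ := Function.update (fun z => T z / z ^ n) 0 c₀ with hS
  have hS0 : S 0 = c₀ := by simp [hS]
  have hSne : ∀ z, z ≠ 0 → S z = T z / z ^ n := fun z hz => by simp [hS, hz]
  have hSO : (fun z => S z - (c₀ + c₁ * z)) =O[𝓝 0] fun z => z ^ 2 := by
    obtain ⟨c, hc⟩ := hT.bound
    refine IsBigO.of_bound c ?_
    filter_upwards [hc] with z hz
    by_cases hz0 : z = 0
    · simp [hz0, hS0]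
    · have h1 : T z - (c₀ * z ^ n + c₁ * z ^ (n + 1)) = (S z - (c₀ + c₁ * z)) * z ^ n := by
        rw [hSne z hz0, sub_mul, div_mul_cancel₀ _ (pow_ne_zero n hz0)]
        ring
      rw [h1, show z ^ (n + 2) = z ^ 2 * z ^ n by ring, norm_mul, norm_mul (z ^ 2), ← mul_assoc] at hz
      exact le_of_mul_le_mul_right hz (norm_pos_iff.2 (pow_ne_zero n hz0))
  have hSd : HasDerivAt S c₁ 0 := by
    rw [hasDerivAt_iff_isLittleO_nhds_zero]
    have h1 : (fun z : ℂ => z ^ 2) =o[𝓝 0] fun z : ℂ => z := by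
      simpa using isLittleO_pow_pow (𝕜 := ℂ) (show 1 < 2 by norm_num)
    refine (hSO.trans_isLittleO h1).congr_left fun z => ?_
    simp [hS0]; ring
  have hSdiff : DifferentiableOn ℂ S (ball 0 1) := by
    rw [← differentiableOn_compl_singleton_and_continuousAt_iff (ball_mem_nhds (0 : ℂ) one_pos)]
    refine ⟨?_, hSd.continuousAt⟩
    refine DifferentiableOn.congr (f := fun z => T z / z ^ n) ?_ fun z hz => hSne z hz.2
    exact (hd.mono sdiff_subset).div (by fun_prop) fun z hz => pow_ne_zero n hz.2
  have hSle : ∀ z ∈ ball (0 : ℂ) 1, z ≠ 0 → ‖S z‖ ≤ 1 := fun z hz hz0 => by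
    rw [hSne z hz0, norm_div, norm_pow]
    exact div_le_one_of_le₀ (hTle z hz) (by positivity)
  have hSm : MapsTo S (ball 0 1) (closedBall 0 1) := by
    intro z hz
    rw [mem_closedBall, dist_zero_right]
    by_cases hz0 : z = 0
    · subst hz0
      have h1 : Tendsto (fun z => ‖S z‖) (𝓝[≠] 0) (𝓝 ‖S 0‖) :=
        hSd.continuousAt.norm.tendsto.mono_left nhdsWithin_le_nhds
      refine le_of_tendsto h1 ?_
      filter_upwards [self_mem_nhdsWithin, mem_nhdsWithin_of_mem_nhds (isOpen_ball.mem_nhds hz)]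
        with w hw hw' using hSle w hw' hw
    · exact hSle z hz hz0
  have := schwarz_pick_of_mapsTo_closedBall hSdiff hSm
  rwa [hS0, hSd.deriv] at this

/-- On the unit disc `B = P / Q`, with `Q` zero-free there and `P` a unimodular multiple of the
polynomial `z ^ N * conj (Q (1 / conj z))`. -/
def IsReflectedQuotient (N : ℕ) (B : ℂ → ℂ) : Prop :=
  ∃ (P Q : ℂ[X]) (ζ : ℂ), Q.natDegree ≤ N ∧ ‖ζ‖ = 1 ∧
    P = C ζ * reflect N (Q.map (starRingEnd ℂ)) ∧
    ∀ z ∈ unitDisc, Q.eval z ≠ 0 ∧ B z * Q.eval z = P.eval z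

lemma IsReflectedQuotient.mul {M N : ℕ} {B B' : ℂ → ℂ} (h : IsReflectedQuotient M B)
    (h' : IsReflectedQuotient N B') : IsReflectedQuotient (M + N) (fun z => B z * B' z) := by
  obtain ⟨P, Q, ζ, hQ, hζ, hP, hB⟩ := h
  obtain ⟨P', Q', ζ', hQ', hζ', hP', hB'⟩ := h'
  refine ⟨P * P', Q * Q', ζ * ζ', natDegree_mul_le.trans (add_le_add hQ hQ'), by simp [hζ, hζ'],
    ?_, fun z hz => ?_⟩
  · rw [Polynomial.map_mul, reflect_mul _ _ (natDegree_map_le.trans hQ)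
      (natDegree_map_le.trans hQ'), hP, hP', C_mul]
    ring
  · obtain ⟨h1, h2⟩ := hB z hz
    obtain ⟨h1', h2'⟩ := hB' z hz
    rw [eval_mul, eval_mul, ← h2, ← h2']
    exact ⟨mul_ne_zero h1 h1', by ring⟩

lemma IsReflectedQuotient.congr {N : ℕ} {B B' : ℂ → ℂ} (h : IsReflectedQuotient N B)
    (hB : ∀ z ∈ unitDisc, B' z = B z) : IsReflectedQuotient N B' := by
  obtain ⟨P, Q, ζ, hQ, hζ, hP, h⟩ := h
  exact ⟨P, Q, ζ, hQ, hζ, hP, fun z hz => by rw [hB z hz]; exact h z hz⟩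

lemma isReflectedQuotient_const {ζ : ℂ} (hζ : ‖ζ‖ = 1) :
    IsReflectedQuotient 0 (fun _ => ζ) :=
  ⟨C ζ, 1, ζ, by simp, hζ, by simp, fun z _ => by simp⟩

lemma isReflectedQuotient_mobius {α : ℂ} (hα : ‖α‖ ≤ 1) :
    IsReflectedQuotient 1 (mobius α) := by
  refine ⟨X - C α, 1 - C (conj α) * X, 1, ?_, by simp, ?_, fun z hz => ?_⟩
  · refine (natDegree_sub_le _ _).trans ?_
    exact max_le (by simp) ((natDegree_C_mul_le _ _).trans natDegree_X_le)
  · have h1 : reflect 1 (1 : ℂ[X]) = X := by simp [reflect_one]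
    have h2 : reflect 1 (X : ℂ[X]) = 1 := by
      simp
    simp [reflect_sub, reflect_C_mul, h1, h2]
  · have hz1 : ‖z‖ < 1 := by simpa [unitDisc] using hz
    have h0 := one_sub_conj_mul_ne_zero hα hz1
    simp only [eval_sub, eval_one, eval_mul, eval_C, eval_X]
    exact ⟨h0, by rw [mobius, div_mul_cancel₀ _ h0]⟩

lemma isReflectedQuotient_prod_mobius : ∀ (k : ℕ) (α : Fin k → ℂ), (∀ j, ‖α j‖ < 1) →
    IsReflectedQuotient k (fun z => ∏ j, mobius (α j) z) := by
  intro k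
  induction k with
  | zero => intro α _; simpa using isReflectedQuotient_const (ζ := 1) (by simp)
  | succ k ih =>
    intro α hα
    simp only [Fin.prod_univ_castSucc]
    exact (ih _ fun j => hα _).mul (isReflectedQuotient_mobius (hα _).le)

/-- The denominator degree bound of a quotient may be raised, since `mobius (-1)` is constant. -/
lemma IsReflectedQuotient.mono {M N : ℕ} {B : ℂ → ℂ} (hMN : M ≤ N)
    (h : IsReflectedQuotient M B) : IsReflectedQuotient N B := by
  induction N, hMN using Nat.le_induction with
  | base => exact h
  | succ N _ ih =>
    refine (ih.mul (isReflectedQuotient_mobius (α := -1) (by simp))).congr fun z hz => ?_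
    have hz1 : ‖z‖ < 1 := by simpa [unitDisc] using hz
    have h0 := one_sub_conj_mul_ne_zero (a := -1) (by simp) hz1
    have h1 : mobius (-1) z = 1 := by
      rw [mobius, div_eq_one_iff_eq h0]
      simp; ring
    rw [h1, mul_one]

lemma IsBlaschkeOn.isReflectedQuotient {B : ℂ → ℂ} {k N : ℕ} (h : IsBlaschkeOn B k)
    (hk : k ≤ N) : IsReflectedQuotient N B := by
  obtain ⟨ζ, α, hζ, hα, hB⟩ := h
  refine (((isReflectedQuotient_const hζ).mul
    (isReflectedQuotient_prod_mobius k α hα)).congr hB).mono (by omega)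

/-- Composing with a Möbius function preserves the class of reflected quotients. -/
lemma IsReflectedQuotient.mobius_comp {N : ℕ} {B : ℂ → ℂ} (h : IsReflectedQuotient N B)
    {β : ℂ} (hβ : ‖β‖ < 1) (hB1 : ∀ z ∈ unitDisc, ‖B z‖ < 1) :
    IsReflectedQuotient N (fun z => mobius β (B z)) := by
  obtain ⟨P, Q, ζ, hQ, hζ, hP, hB⟩ := h
  have hP' : P.natDegree ≤ N := by
    rw [hP]
    refine (natDegree_C_mul_le _ _).trans (natDegree_le_iff_coeff_eq_zero.2 fun j hj => ?_)
    rw [coeff_reflect, revAt_eq_self_of_lt hj, coeff_map,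
      coeff_eq_zero_of_natDegree_lt (hQ.trans_lt hj), map_zero]
  have hζζ : ζ * conj ζ = 1 := by rw [mul_conj']; simp [hζ]
  have hQP : Q = C ζ * reflect N (P.map (starRingEnd ℂ)) := by
    ext j
    rw [coeff_C_mul, coeff_reflect, coeff_map, hP, coeff_C_mul, coeff_reflect, coeff_map,
      revAt_invol, map_mul, conj_conj, ← mul_assoc, hζζ, one_mul]
  refine ⟨P - C β * Q, Q - C (conj β) * P, ζ, ?_, hζ, ?_, fun z hz => ?_⟩
  · exact (natDegree_sub_le _ _).trans
      (max_le hQ ((natDegree_C_mul_le _ _).trans hP'))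
  · rw [Polynomial.map_sub, reflect_sub, mul_sub, ← hP, Polynomial.map_mul, map_C, conj_conj,
      reflect_C_mul, mul_left_comm, ← hQP]
  · obtain ⟨h1, h2⟩ := hB z hz
    have h0 := one_sub_conj_mul_ne_zero hβ.le (hB1 z hz)
    have h3 : (Q - C (conj β) * P).eval z = (1 - conj β * B z) * Q.eval z := by
      rw [eval_sub, eval_mul, eval_C, ← h2]; ring
    rw [h3]
    refine ⟨mul_ne_zero h0 h1, ?_⟩
    beta_reduce
    rw [mobius, ← mul_assoc, div_mul_cancel₀ _ h0, eval_sub, eval_mul, eval_C, ← h2]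
    ring

/-- For a reflected quotient of degree `n + 1` vanishing to order `n` at the origin, the
Schwarz–Pick inequality between the leading Taylor coefficients is reversed. -/
lemma IsReflectedQuotient.one_le_norm_sq_add_norm {n : ℕ} {B : ℂ → ℂ} {c₀ c₁ : ℂ}
    (h : IsReflectedQuotient (n + 1) B)
    (hT : (fun z => B z - (c₀ * z ^ n + c₁ * z ^ (n + 1))) =O[𝓝 0] fun z => z ^ (n + 2)) :
    1 ≤ ‖c₀‖ ^ 2 + ‖c₁‖ := by
  obtain ⟨P, Q, ζ, hQ, hζ, hP, hB⟩ := h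
  have hO : (fun z => (P - (C c₀ * X ^ n + C c₁ * X ^ (n + 1)) * Q).eval z) =O[𝓝[≠] 0]
      fun z => z ^ (n + 2) := by
    have h1 : (fun z => Q.eval z) =O[𝓝 0] fun _ => (1 : ℂ) :=
      (Q.continuous.tendsto 0).isBigO_one ℂ
    have h2 := (hT.mul h1).mono (nhdsWithin_le_nhds (s := {0}ᶜ))
    simp only [mul_one] at h2
    refine h2.congr' ?_ EventuallyEq.rfl
    filter_upwards [mem_nhdsWithin_of_mem_nhds (ball_mem_nhds (0 : ℂ) one_pos)] with z hz
    rw [eval_sub, ← (hB z hz).2]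
    simp
    ring
  have hcoeff := polynomial_coeff_eq_zero_of_isBigO _ _ hO
  have e0 := hcoeff n (by omega)
  have e1 := hcoeff (n + 1) (by omega)
  have p0 : P.coeff n = ζ * conj (Q.coeff 1) := by
    rw [hP, coeff_C_mul, coeff_reflect, coeff_map, revAt_le (by omega)]
    simp
  have p1 : P.coeff (n + 1) = ζ * conj (Q.coeff 0) := by
    rw [hP, coeff_C_mul, coeff_reflect, coeff_map, revAt_le le_rfl]
    simp
  have r0 : ((C c₀ * X ^ n + C c₁ * X ^ (n + 1)) * Q).coeff n = c₀ * Q.coeff 0 := by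
    simp [add_mul, mul_assoc, coeff_X_pow_mul']
  have r1 : ((C c₀ * X ^ n + C c₁ * X ^ (n + 1)) * Q).coeff (n + 1)
      = c₀ * Q.coeff 1 + c₁ * Q.coeff 0 := by
    simp [add_mul, mul_assoc, coeff_X_pow_mul']
  rw [coeff_sub, p0, r0, sub_eq_zero] at e0
  rw [coeff_sub, p1, r1, sub_eq_zero] at e1
  have q0 : 0 < ‖Q.coeff 0‖ := by
    rw [norm_pos_iff, coeff_zero_eq_eval_zero]
    exact (hB 0 (by simp [unitDisc])).1
  have n0 : ‖Q.coeff 1‖ = ‖c₀‖ * ‖Q.coeff 0‖ := by simpa [hζ] using congrArg norm e0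
  have n1 : ‖Q.coeff 0‖ ≤ ‖c₀‖ * ‖Q.coeff 1‖ + ‖c₁‖ * ‖Q.coeff 0‖ := by
    have : ‖Q.coeff 0‖ = ‖c₀ * Q.coeff 1 + c₁ * Q.coeff 0‖ := by simpa [hζ] using congrArg norm e1
    calc _ = _ := this
      _ ≤ _ := norm_add_le _ _
      _ = _ := by rw [norm_mul, norm_mul]
  rw [n0] at n1
  refine le_of_mul_le_mul_right ?_ q0
  linarith

/-- A function of two variables, bounded and separately holomorphic on a polydisc, is a sum of
functions of one variable up to an error of size `O(|x| |y|)`. -/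
lemma norm_mixed_difference_le {G : ℂ → ℂ → ℂ} {r : ℝ} (hr : 0 < r)
    (hx : ∀ y ∈ ball (0 : ℂ) r, DifferentiableOn ℂ (fun x => G x y) (ball 0 r))
    (hy : ∀ x ∈ ball (0 : ℂ) r, DifferentiableOn ℂ (G x) (ball 0 r))
    (hG : ∀ x ∈ ball (0 : ℂ) r, ∀ y ∈ ball (0 : ℂ) r, ‖G x y‖ ≤ 1) :
    ∀ x ∈ ball (0 : ℂ) r, ∀ y ∈ ball (0 : ℂ) r,
      ‖G x y - G x 0 - (G 0 y - G 0 0)‖ ≤ 4 / r * ‖y‖ / r * ‖x‖ := by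
  have h0 : (0 : ℂ) ∈ ball (0 : ℂ) r := by simpa using hr
  have step : ∀ x ∈ ball (0 : ℂ) r, ∀ y ∈ ball (0 : ℂ) r,
      ‖G x y - G x 0 - (G 0 y - G 0 0)‖ ≤ 4 / r * ‖y‖ := by
    intro x hx' y hy'
    have := dist_le_div_mul_dist_of_mapsTo_ball (R₂ := 4)
      (f := fun y => G x y - G x 0 - (G 0 y - G 0 0)) (c := 0) (R₁ := r) (z := y)
      (((hy x hx').sub_const _).sub ((hy 0 h0).sub_const _)) (by
        intro w hw
        simp only [sub_self, mem_closedBall, dist_zero_right]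
        calc _ ≤ ‖G x w‖ + ‖G x 0‖ + (‖G 0 w‖ + ‖G 0 0‖) :=
              (norm_sub_le _ _).trans (add_le_add (norm_sub_le _ _) (norm_sub_le _ _))
          _ ≤ 4 := by
            linarith [hG x hx' w hw, hG x hx' 0 h0, hG 0 h0 w hw, hG 0 h0 0 h0]) hy'
    simpa using this
  intro x hx' y hy'
  have := dist_le_div_mul_dist_of_mapsTo_ball (R₂ := 4 / r * ‖y‖)
    (f := fun x => G x y - G x 0 - (G 0 y - G 0 0)) (c := 0) (R₁ := r) (z := x)
    (((hx y hy').sub (hx 0 h0)).sub_const _) (by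
      intro w hw
      simp only [sub_self, mem_closedBall, dist_zero_right]
      exact step w hw y hy') hx'
  simpa using this

lemma exists_quadratic_expansion {g : ℂ → ℂ} {r : ℝ} (hr : 0 < r)
    (hd : DifferentiableOn ℂ g (ball 0 r)) : ∃ p q : ℂ,
      (fun z => g z - (g 0 + p * z + q * z ^ 2)) =O[𝓝 0] fun z => z ^ 3 := by
  obtain ⟨s, hs⟩ := hd.analyticAt (ball_mem_nhds 0 hr)
  have h := hs.isBigO_sub_partialSum_pow 3
  refine ⟨s.coeff 1, s.coeff 2, ?_⟩
  have h' := h.trans (k := fun z : ℂ => z ^ 3)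
    (IsBigO.of_norm_right (by simpa using isBigO_refl _ _))
  refine h'.congr_left fun z => ?_
  have h00 : s.coeff 0 = g 0 := hs.coeff_zero _
  simp [FormalMultilinearSeries.partialSum, Finset.sum_range_succ, h00]
  ring

/-- Weighted Taylor expansion of a separately holomorphic function along
`z ↦ (x * z ^ n, y * z ^ (n + 1))`. -/
lemma exists_weighted_expansion {G : ℂ → ℂ → ℂ} {r : ℝ} (hr : 0 < r)
    (hx : ∀ y ∈ ball (0 : ℂ) r, DifferentiableOn ℂ (fun x => G x y) (ball 0 r))
    (hy : ∀ x ∈ ball (0 : ℂ) r, DifferentiableOn ℂ (G x) (ball 0 r))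
    (hG : ∀ x ∈ ball (0 : ℂ) r, ∀ y ∈ ball (0 : ℂ) r, ‖G x y‖ ≤ 1) (hG0 : G 0 0 = 0)
    {n : ℕ} (hn : 1 ≤ n) :
    ∃ p q s : ℂ, ∀ x y : ℂ,
      (fun z => G (x * z ^ n) (y * z ^ (n + 1))
        - ((p * x) * z ^ n + (s * y + q * x ^ 2) * z ^ (n + 1))) =O[𝓝 0] fun z => z ^ (n + 2) := by
  have h0 : (0 : ℂ) ∈ ball (0 : ℂ) r := by simpa using hr
  obtain ⟨p, q, hpq⟩ := exists_quadratic_expansion hr (hx 0 h0)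
  obtain ⟨s, t, hst⟩ := exists_quadratic_expansion hr (hy 0 h0)
  refine ⟨p, if n = 1 then q else 0, s, fun x y => ?_⟩
  have hpow : ∀ k : ℕ, n + 2 ≤ k → (fun z : ℂ => z ^ k) =O[𝓝 0] fun z : ℂ => z ^ (n + 2) :=
    fun k hk => IsBigO.of_bound 1 (by
      filter_upwards [ball_mem_nhds (0 : ℂ) one_pos] with z hz
      rw [one_mul, norm_pow, norm_pow]
      exact pow_le_pow_of_le_one (norm_nonneg _) (by simpa using (mem_ball.1 hz).le) hk)
  have tx : Tendsto (fun z : ℂ => x * z ^ n) (𝓝 0) (𝓝 0) := by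
    have : Tendsto (fun z : ℂ => x * z ^ n) (𝓝 0) (𝓝 (x * 0 ^ n)) :=
      Continuous.tendsto (by fun_prop) 0
    simpa [show n ≠ 0 by omega] using this
  have ty : Tendsto (fun z : ℂ => y * z ^ (n + 1)) (𝓝 0) (𝓝 0) := by
    have : Tendsto (fun z : ℂ => y * z ^ (n + 1)) (𝓝 0) (𝓝 (y * 0 ^ (n + 1))) :=
      Continuous.tendsto (by fun_prop) 0
    simpa using this
  have hX : (fun z : ℂ => (x * z ^ n) ^ 3) =O[𝓝 0] fun z : ℂ => z ^ (n + 2) :=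
    ((hpow (n * 3) (by omega)).const_mul_left (x ^ 3)).congr_left fun z => by ring
  have hY : (fun z : ℂ => (y * z ^ (n + 1)) ^ 3) =O[𝓝 0] fun z : ℂ => z ^ (n + 2) :=
    ((hpow ((n + 1) * 3) (by omega)).const_mul_left (y ^ 3)).congr_left fun z => by ring
  have hY2 : (fun z : ℂ => t * (y * z ^ (n + 1)) ^ 2) =O[𝓝 0] fun z : ℂ => z ^ (n + 2) :=
    ((hpow ((n + 1) * 2) (by omega)).const_mul_left (t * y ^ 2)).congr_left fun z => by ring
  have hX2 : (fun z : ℂ => q * (x * z ^ n) ^ 2 - (if n = 1 then q else 0) * x ^ 2 * z ^ (n + 1))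
      =O[𝓝 0] fun z : ℂ => z ^ (n + 2) := by
    by_cases h1 : n = 1
    · subst h1
      simp only [if_true]
      refine (isBigO_zero _ _).congr_left fun z => ?_
      ring
    · simp only [h1, if_false]
      exact ((hpow (n * 2) (by omega)).const_mul_left (q * x ^ 2)).congr_left fun z => by ring
  have hM : (fun z : ℂ => G (x * z ^ n) (y * z ^ (n + 1)) - G (x * z ^ n) 0
      - (G 0 (y * z ^ (n + 1)) - G 0 0)) =O[𝓝 0] fun z : ℂ => z ^ (n + 2) := by
    refine IsBigO.trans (IsBigO.of_bound (4 / r / r * ‖x‖ * ‖y‖) ?_)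
      (hpow (n + (n + 1)) (by omega))
    filter_upwards [tx (ball_mem_nhds 0 hr), ty (ball_mem_nhds 0 hr)] with z h1 h2
    refine (norm_mixed_difference_le hr hx hy hG _ h1 _ h2).trans_eq ?_
    simp only [norm_mul, norm_pow]
    ring
  have e1 := (hpq.comp_tendsto tx).trans hX
  have e2 := (hst.comp_tendsto ty).trans hY
  refine ((((hM.add e1).add e2).add hX2).add hY2).congr_left fun z => ?_
  simp only [Function.comp, hG0]
  ring

lemma exists_norm_one_norm_mul_add (x y : ℂ) : ∃ e : ℂ, ‖e‖ = 1 ∧ ‖x * e + y‖ = ‖x‖ + ‖y‖ := by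
  by_cases hx : x = 0
  · exact ⟨1, by simp, by simp [hx]⟩
  by_cases hy : y = 0
  · exact ⟨1, by simp, by simp [hy]⟩
  have hx' : (‖x‖ : ℂ) ≠ 0 := by simpa using hx
  have hy' : (‖y‖ : ℂ) ≠ 0 := by simpa using hy
  refine ⟨y / ‖y‖ * (‖x‖ / x), by simp [hx, hy], ?_⟩
  have : x * (y / ‖y‖ * (‖x‖ / x)) + y = y / ‖y‖ * ((‖x‖ + ‖y‖ : ℝ) : ℂ) := by
    push_cast
    field_simp
  rw [this, norm_mul, norm_real, Real.norm_of_nonneg (by positivity)]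
  simp [hy]

/-- The quadratic `s ↦ C * s ^ 2 + A * (1 - (a + s) ^ 2)` has no interior maximum at `s = a`. -/
lemma quadratic_slice_bound_false {a b A C : ℝ} (ha : 0 < a) (hb : 0 < b)
    (hab : 4 * a ^ 2 + b = 1) (hA : 0 ≤ A)
    (hle : ∀ σ ρ : ℝ, 0 < σ → 0 < ρ → (a + σ) ^ 2 + ρ < 1 → C * σ ^ 2 + A * ρ ≤ 1)
    (hge : 1 ≤ C * a ^ 2 + A * b) : False := by
  have hmax : IsLocalMax (fun s => C * s ^ 2 + A * (1 - (a + s) ^ 2)) a := by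
    have h1 : ∀ᶠ s : ℝ in 𝓝 a, 0 < s := lt_mem_nhds ha
    have h2 : ∀ᶠ s : ℝ in 𝓝 a, 0 < 1 - (a + s) ^ 2 :=
      (ContinuousAt.eventually_lt (by fun_prop) (by fun_prop) (by nlinarith))
    filter_upwards [h1, h2] with s hs1 hs2
    have hlim : Tendsto (fun ρ : ℝ => C * s ^ 2 + A * ρ) (𝓝[<] (1 - (a + s) ^ 2))
        (𝓝 (C * s ^ 2 + A * (1 - (a + s) ^ 2))) :=
      (Continuous.tendsto (by fun_prop) _).mono_left nhdsWithin_le_nhds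
    have h3 := le_of_tendsto hlim (by
      filter_upwards [Ioo_mem_nhdsLT hs2] with ρ hρ
      exact hle s ρ hs1 hρ.1 (by linarith [hρ.2]))
    have h4 : 1 - (a + a) ^ 2 = b := by linarith
    rw [h4]
    linarith
  have hderiv : HasDerivAt (fun s => C * s ^ 2 + A * (1 - (a + s) ^ 2))
      (C * (2 * a) - A * (2 * (a + a))) a := by
    have h1 := ((hasDerivAt_id a).pow 2).const_mul C
    have h2 := ((((hasDerivAt_id a).const_add a).pow 2).const_sub 1).const_mul A
    refine (h1.add h2).congr_deriv ?_
    simp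
    ring
  have hz := hmax.hasDerivAt_eq_zero hderiv
  have hC : C = 2 * A := by
    have : a * (C - 2 * A) = 0 := by linarith
    rcases mul_eq_zero.1 this with h | h
    · exact absurd h ha.ne'
    · linarith
  subst hC
  obtain ⟨ε, hε, hball⟩ := Metric.eventually_nhds_iff.1 hmax
  have h1 := hball (y := a + ε / 2) (by simp [abs_of_pos hε]; linarith)
  have h2 : A * (ε / 2) ^ 2 ≤ 0 := by nlinarith
  have hA0 : A = 0 := by
    by_contra h
    have : 0 < A := lt_of_le_of_ne hA (Ne.symm h)
    have : 0 < A * (ε / 2) ^ 2 := by positivity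
    linarith
  subst hA0
  linarith

/-- No bounded holomorphic function on the domain restricts to a quotient of degree `n + 1`
along the disc `z ↦ (a, a * z ^ n, b * z ^ (n + 1))`. -/
lemma not_isReflectedQuotient_slice {n : ℕ} (hn : 1 ≤ n) {a b : ℝ} (ha : 0 < a) (hb : 0 < b)
    (hab : 4 * a ^ 2 + b = 1) {F : (Fin 3 → ℂ) → ℂ}
    (hFd : DifferentiableOn ℂ F {z | (‖z 0‖ + ‖z 1‖) ^ 2 + ‖z 2‖ < 1})
    (hFm : MapsTo F {z | (‖z 0‖ + ‖z 1‖) ^ 2 + ‖z 2‖ < 1} unitDisc) :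
    ¬ IsReflectedQuotient (n + 1)
      (fun z => F ![(a : ℂ), (a : ℂ) * z ^ n, (b : ℂ) * z ^ (n + 1)]) := by
  intro hB
  set D : Set (Fin 3 → ℂ) := {z | (‖z 0‖ + ‖z 1‖) ^ 2 + ‖z 2‖ < 1} with hD
  have ha2 : 2 * a < 1 := by nlinarith
  have hmem : ∀ x y : ℂ, (a + ‖x‖) ^ 2 + ‖y‖ < 1 → ![(a : ℂ), x, y] ∈ D := by
    intro x y h
    simpa [hD, abs_of_pos ha] using h
  have hF1 : ∀ w ∈ D, ‖F w‖ < 1 := fun w hw => by simpa [unitDisc] using hFm hw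
  set β := F ![(a : ℂ), 0, 0] with hβ
  have hβ1 : ‖β‖ < 1 := hF1 _ (hmem 0 0 (by rw [norm_zero]; nlinarith))
  set G : ℂ → ℂ → ℂ := fun x y => mobius β (F ![(a : ℂ), x, y]) with hGdef
  have hG1 : ∀ x y : ℂ, (a + ‖x‖) ^ 2 + ‖y‖ < 1 → ‖G x y‖ < 1 := fun x y h =>
    norm_mobius_lt_one hβ1 (hF1 _ (hmem x y h))
  have hcomp : ∀ (U : Set ℂ) (u v : ℂ → ℂ), DifferentiableOn ℂ u U → DifferentiableOn ℂ v U →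
      (∀ z ∈ U, (a + ‖u z‖) ^ 2 + ‖v z‖ < 1) →
      DifferentiableOn ℂ (fun z => G (u z) (v z)) U := by
    intro U u v hu hv huv
    have h1 : DifferentiableOn ℂ (fun z => ![(a : ℂ), u z, v z]) U := by
      rw [differentiableOn_pi]
      intro i
      fin_cases i
      · exact differentiableOn_const _
      · exact hu
      · exact hv
    have h2 : DifferentiableOn ℂ (fun z => F ![(a : ℂ), u z, v z]) U :=
      hFd.comp h1 fun z hz => hmem _ _ (huv z hz)
    intro z hz
    exact (differentiableAt_mobius hβ1.le (hF1 _ (hmem _ _ (huv z hz)))).comp_differentiableWithinAt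
      z (h2 z hz)
  obtain ⟨r, hr, hra⟩ : ∃ r : ℝ, 0 < r ∧ (a + r) ^ 2 + r < 1 :=
    ⟨(1 - 2 * a) / 4, by linarith, by nlinarith⟩
  have hball : ∀ x ∈ ball (0 : ℂ) r, ∀ y ∈ ball (0 : ℂ) r, (a + ‖x‖) ^ 2 + ‖y‖ < 1 := by
    intro x hx y hy
    rw [mem_ball, dist_zero_right] at hx hy
    have : (a + ‖x‖) ^ 2 ≤ (a + r) ^ 2 := by gcongr
    linarith
  obtain ⟨p, q, s, hexp⟩ := exists_weighted_expansion (G := G) hr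
    (fun y hy => hcomp _ _ _ differentiableOn_id (differentiableOn_const y)
      fun x hx => hball x hx y hy)
    (fun x hx => hcomp _ _ _ (differentiableOn_const x) differentiableOn_id
      fun y hy => hball x hx y hy)
    (fun x hx y hy => (hG1 x y (hball x hx y hy)).le) (mobius_self β) hn
  have hmono : ∀ (x y z : ℂ), ‖z‖ < 1 →
      (a + ‖x * z ^ n‖) ^ 2 + ‖y * z ^ (n + 1)‖ ≤ (a + ‖x‖) ^ 2 + ‖y‖ := by
    intro x y z hz
    have h1 : ∀ (w : ℂ) (j : ℕ), ‖w * z ^ j‖ ≤ ‖w‖ := fun w j => by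
      rw [norm_mul, norm_pow]
      exact mul_le_of_le_one_right (norm_nonneg _) (pow_le_one₀ (norm_nonneg _) hz.le)
    have := h1 x n
    have := h1 y (n + 1)
    gcongr
  have hdisc : ∀ z ∈ unitDisc, (a + ‖(a : ℂ) * z ^ n‖) ^ 2 + ‖(b : ℂ) * z ^ (n + 1)‖ < 1 := by
    intro z hz
    have hz1 : ‖z‖ < 1 := by simpa [unitDisc] using hz
    have h1 : ‖z‖ ^ n < 1 := pow_lt_one₀ (norm_nonneg _) hz1 (by omega)
    have h2 : ‖z‖ ^ (n + 1) < 1 := pow_lt_one₀ (norm_nonneg _) hz1 (by omega)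
    have h3 : (a + a * ‖z‖ ^ n) ^ 2 ≤ (a + a) ^ 2 := by
      gcongr
      exact mul_le_of_le_one_right ha.le h1.le
    have h4 : b * ‖z‖ ^ (n + 1) < b := mul_lt_of_lt_one_right hb h2
    simp only [norm_mul, norm_pow, norm_real, Real.norm_of_nonneg ha.le, Real.norm_of_nonneg hb.le]
    linarith
  have hupper : ∀ σ ρ : ℝ, 0 < σ → 0 < ρ → (a + σ) ^ 2 + ρ < 1 →
      (‖p‖ ^ 2 + ‖q‖) * σ ^ 2 + ‖s‖ * ρ ≤ 1 := by
    intro σ ρ hσ hρ h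
    obtain ⟨e, he, hse⟩ := exists_norm_one_norm_mul_add (s * ρ) (q * σ ^ 2)
    have hin : ∀ z ∈ ball (0 : ℂ) 1,
        (a + ‖(σ : ℂ) * z ^ n‖) ^ 2 + ‖(ρ * e) * z ^ (n + 1)‖ < 1 := fun z hz => by
      refine (hmono _ _ z (by simpa using hz)).trans_lt ?_
      simpa [he, abs_of_pos hσ, abs_of_pos hρ] using h
    have h1 := norm_sq_add_norm_le_one_of_expansion hn
      (hcomp _ _ _ (by fun_prop) (by fun_prop) hin)
      (fun z hz => by simpa using (hG1 _ _ (hin z hz)).le) (hexp σ (ρ * e))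
    rw [show s * (ρ * e) + q * σ ^ 2 = s * ρ * e + q * σ ^ 2 by ring, hse] at h1
    simp only [norm_mul, norm_pow, norm_real, Real.norm_of_nonneg hσ.le,
      Real.norm_of_nonneg hρ.le] at h1
    linarith
  have hlower := (hB.mobius_comp hβ1 fun z hz =>
    hF1 _ (hmem _ _ (hdisc z hz))).one_le_norm_sq_add_norm (hexp a b)
  refine quadratic_slice_bound_false ha hb hab (norm_nonneg s) hupper (hlower.trans ?_)
  have h1 := norm_add_le (s * b) (q * a ^ 2)
  simp only [norm_mul, norm_pow, norm_real, Real.norm_of_nonneg ha.le,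
    Real.norm_of_nonneg hb.le] at h1 ⊢
  linarith

end Helpers

/-- For `m ≥ 4` and `a, b > 0` with `4a² + b = 1`, the map
`f(λ) = (aλ, aλ^{m-2}, bλ^{m-1})` maps `𝔻` into
`D = {z ∈ ℂ³ : (|z₁| + |z₂|)² + |z₃| < 1}` and is an `m`-geodesic of `D`, while
`φ(λ) = f(λ)/λ = (a, aλ^{m-3}, bλ^{m-2})` is not an `(m-1)`-geodesic of `D`. -/
theorem geodesic_with_quotient_not_geodesic_in_special_domain
    (m : ℕ) (hm : 4 ≤ m) (a b : ℝ) (ha : 0 < a) (hb : 0 < b)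
    (hab : 4 * a ^ 2 + b = 1)
    (D : Set (Fin 3 → ℂ)) (hD : D = {z | (‖z 0‖ + ‖z 1‖) ^ 2 + ‖z 2‖ < 1})
    (f : ℂ → Fin 3 → ℂ)
    (hf : f = fun z => ![(a : ℂ) * z, (a : ℂ) * z ^ (m - 2), (b : ℂ) * z ^ (m - 1)])
    (φ : ℂ → Fin 3 → ℂ)
    (hφ : φ = fun z => ![(a : ℂ), (a : ℂ) * z ^ (m - 3), (b : ℂ) * z ^ (m - 2)]) :
    Set.MapsTo f unitDisc D ∧ IsGeodesic D f m ∧ ¬ IsGeodesic D φ (m - 1) := by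
  subst hD hf hφ
  have ha2 : 2 * a < 1 := by nlinarith
  refine ⟨fun z hz => ?_, ⟨fun w => 4 * w 0 * w 1 + w 2, ?_, fun w hw => ?_, m - 1, by omega,
    le_rfl, 1, 0, by simp, by simp, fun z _ => ?_⟩, ?_⟩
  · have hz1 : ‖z‖ < 1 := by simpa [unitDisc] using hz
    have h1 : ‖z‖ ^ (m - 2) ≤ ‖z‖ :=
      pow_le_of_le_one (norm_nonneg _) hz1.le (by omega)
    have h2 : ‖z‖ ^ (m - 1) ≤ ‖z‖ :=
      pow_le_of_le_one (norm_nonneg _) hz1.le (by omega)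
    have h3 : a * ‖z‖ + a * ‖z‖ ^ (m - 2) ≤ 2 * a * ‖z‖ := by nlinarith
    have h4 : (a * ‖z‖ + a * ‖z‖ ^ (m - 2)) ^ 2 ≤ (2 * a * ‖z‖) ^ 2 :=
      pow_le_pow_left₀ (by positivity) h3 2
    have h5 : b * ‖z‖ ^ (m - 1) ≤ b * ‖z‖ := by gcongr
    have h6 : (2 * a * ‖z‖) ^ 2 ≤ 4 * a ^ 2 * ‖z‖ := by
      have : ‖z‖ ^ 2 ≤ ‖z‖ := pow_le_of_le_one (norm_nonneg _) hz1.le two_ne_zero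
      nlinarith [sq_nonneg a]
    have h7 : 4 * a ^ 2 * ‖z‖ + b * ‖z‖ = ‖z‖ := by rw [← add_mul, hab, one_mul]
    simp [abs_of_pos ha, abs_of_pos hb]
    linarith
  · exact Differentiable.differentiableOn (by fun_prop)
  · rw [mem_ofPred_eq] at hw
    simp only [unitDisc, mem_ball, dist_zero_right]
    refine lt_of_le_of_lt (norm_add_le _ _) (lt_of_le_of_lt ?_ hw)
    simp only [norm_mul]
    norm_num
    nlinarith [sq_nonneg (‖w 0‖ - ‖w 1‖)]
  · have h1 : z ^ (m - 1) = z * z ^ (m - 2) := by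
      rw [← pow_succ']; congr 1; omega
    have h2 : (4 * (a : ℂ) ^ 2 + b) = 1 := by exact_mod_cast hab
    simp [mobius]
    rw [h1]
    linear_combination (z * z ^ (m - 2)) * h2
  · rintro ⟨F, hFd, hFm, k, -, hk, hB⟩
    obtain ⟨n, rfl⟩ : ∃ n, m = n + 3 := ⟨m - 3, by omega⟩
    simp only [Nat.add_sub_cancel, show n + 3 - 2 = n + 1 by omega] at hB
    exact not_isReflectedQuotient_slice (by omega) ha hb hab hFd hFm
      (hB.isReflectedQuotient (by omega))
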